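/- Let g be a real symmetric invertible 4×4 matrix of Lorentzian signature, let σ ∈ ℝ⁴ satisfy σᵀ g^{-1} σ < 0, set V := √(−σᵀ g^{-1} σ), σ̂ := σ / V, and e := g + 2 σ̂ σ̂ᵀ. Writing g^{ab} for the entries of g^{-1} and e^{cd} for the entries of e^{-1}, the following identity holds for all c, d: Σ_{a,b} ( g^{ac} g^{bd} − (1/2) g^{ab} g^{cd} ) σ_a σ̂_b = (1/2) V e^{cd}. -/

import Mathlib

open Matrix

/-- The Minkowski matrix diag(-1,1,1,1). -/
def minkowskiMat : Matrix (Fin 4) (Fin 4) ℝ :=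
  Matrix.diagonal (fun i => if i = 0 then -1 else 1)

/-- A real symmetric 4×4 matrix has Lorentzian signature if it is congruent to
diag(-1,1,1,1). -/
def IsLorentzian (g : Matrix (Fin 4) (Fin 4) ℝ) : Prop :=
  ∃ P : Matrix (Fin 4) (Fin 4) ℝ, IsUnit P.det ∧ Pᵀ * g * P = minkowskiMat

/-- If `g` is symmetric and invertible and `s` is a covector with `g⁻¹(s, s) = -1`, then the
inverse of `g + 2 s sᵀ` is `g⁻¹ + 2 u uᵀ` with `u = g⁻¹ s`. -/
theorem inv_add_two_smul_vecMulVec {n R : Type*} [Fintype n] [DecidableEq n] [CommRing R]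
    {g : Matrix n n R} (hsym : g.IsSymm) (hinv : IsUnit g.det) {s : n → R}
    (hs : s ⬝ᵥ g⁻¹ *ᵥ s = -1) :
    (g + (2 : R) • vecMulVec s s)⁻¹ = g⁻¹ + (2 : R) • vecMulVec (g⁻¹ *ᵥ s) (g⁻¹ *ᵥ s) := by
  have hsi : (g⁻¹)ᵀ = g⁻¹ := by rw [transpose_nonsing_inv, hsym.eq]
  have hvec : s ᵥ* g⁻¹ = g⁻¹ *ᵥ s := by rw [← mulVec_transpose, hsi]
  apply inv_eq_right_inv
  have hg : g * vecMulVec (g⁻¹ *ᵥ s) (g⁻¹ *ᵥ s) = vecMulVec s (g⁻¹ *ᵥ s) := by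
    rw [mul_vecMulVec, mulVec_mulVec, mul_nonsing_inv g hinv, one_mulVec]
  have hss : vecMulVec s s * vecMulVec (g⁻¹ *ᵥ s) (g⁻¹ *ᵥ s) = -vecMulVec s (g⁻¹ *ᵥ s) := by
    rw [vecMulVec_mul_vecMulVec, hs, neg_one_smul, vecMulVec_neg]
  rw [add_mul, mul_add, mul_add, mul_nonsing_inv g hinv, Matrix.smul_mul, Matrix.smul_mul,
    Matrix.mul_smul, Matrix.mul_smul, hg, hss, vecMulVec_mul, hvec]
  module

/-- Contracting `g^{ac} g^{bd} - (1/2) g^{ab} g^{cd}` with the timelike covector `σ`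
and its normalisation `σ̂` yields `(1/2) V e^{cd}`, where `e = g + 2 σ̂ σ̂ᵀ`. -/
theorem energy_contraction_identity (g : Matrix (Fin 4) (Fin 4) ℝ) (hsym : g.IsSymm)
    (hinv : IsUnit g.det) (hlor : IsLorentzian g)
    (σ : Fin 4 → ℝ) (hσ : σ ⬝ᵥ g⁻¹.mulVec σ < 0)
    (V : ℝ) (hV : V = Real.sqrt (-(σ ⬝ᵥ g⁻¹.mulVec σ)))
    (σh : Fin 4 → ℝ) (hσh : σh = V⁻¹ • σ)
    (e : Matrix (Fin 4) (Fin 4) ℝ) (he : e = g + (2:ℝ) • Matrix.vecMulVec σh σh) :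
    ∀ c d, ∑ a, ∑ b', (g⁻¹ a c * g⁻¹ b' d - (1/2) * g⁻¹ a b' * g⁻¹ c d) * σ a * σh b'
      = (1/2) * V * e⁻¹ c d := by
  have hV0 : V ≠ 0 := by
    rw [hV]
    exact (Real.sqrt_pos.2 (neg_pos.2 hσ)).ne'
  have hV2 : σ ⬝ᵥ g⁻¹ *ᵥ σ = -(V * V) := by
    rw [hV, Real.mul_self_sqrt (neg_pos.2 hσ).le, neg_neg]
  have hs : σh ⬝ᵥ g⁻¹ *ᵥ σh = -1 := by
    rw [hσh, mulVec_smul, smul_dotProduct, dotProduct_smul, hV2, smul_eq_mul, smul_eq_mul]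
    field_simp
  have hσV : σ = V • σh := by rw [hσh, smul_inv_smul₀ hV0]
  have hsi : ∀ a b, g⁻¹ a b = g⁻¹ b a := by
    have : (g⁻¹).IsSymm := by rw [IsSymm, transpose_nonsing_inv, hsym.eq]
    exact fun a b => this.apply b a
  have hu : ∀ c, (g⁻¹ *ᵥ σh) c = ∑ a, g⁻¹ a c * σh a := by
    intro c
    simp only [mulVec, dotProduct]
    exact Finset.sum_congr rfl fun a _ => by rw [hsi]
  intro c d
  have hsplit : ∑ a, ∑ b', (g⁻¹ a c * g⁻¹ b' d - (1/2) * g⁻¹ a b' * g⁻¹ c d) * σ a * σh b'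
      = V * ((g⁻¹ *ᵥ σh) c * (g⁻¹ *ᵥ σh) d)
        - (1/2) * V * g⁻¹ c d * (σh ⬝ᵥ g⁻¹ *ᵥ σh) := by
    rw [hu, hu, Finset.sum_mul_sum]
    simp only [dotProduct, mulVec, Finset.mul_sum, ← Finset.sum_sub_distrib]
    refine Finset.sum_congr rfl fun a _ => Finset.sum_congr rfl fun b _ => ?_
    rw [hσV, Pi.smul_apply, smul_eq_mul]
    ring
  rw [hsplit, hs, he, inv_add_two_smul_vecMulVec hsym hinv hs]
  simp only [Matrix.add_apply, Matrix.smul_apply, vecMulVec_apply, smul_eq_mul]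
  ring
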